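/- Let Γ be a primitive G-set of the form Γ = span((i,0,0),(i_y,j,0),(i_z,0,k)), with y-valley (i_y,0) and z-valley (i_z,0), where i = i(Γ), j = j(Γ), k = k(Γ). If j < k, then TU(TUR^j(Γ)) = span((i+i_z+1,0,0),(i,j,0),(i_z,0,k−(j+1))), and if in addition j < k−1 this G-set is primitive. If k < j, then TU(TUL^k(Γ)) = span((i+i_y+1,0,0),(i_y,j−(k+1),0),(i,0,k)), and if in addition k < j−1 this G-set is primitive. -/

import Mathlib

open scoped BigOperators Classical

namespace GH

/-- Exponent vectors of monomials `x^m y^n z^p`. -/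
abbrev N3 : Type := ℕ × ℕ × ℕ

/-- The lattice `ℤ³`. -/
abbrev Z3 : Type := ℤ × ℤ × ℤ

/-- Inclusion `ℕ³ → ℤ³`. -/
def toZ (v : N3) : Z3 := ((v.1 : ℤ), (v.2.1 : ℤ), (v.2.2 : ℤ))

/-- The weight map `wt(m,n,p) = m + a·n + (r−a)·p (mod r)` on `ℤ³`. -/
def wtZ (r a : ℕ) (v : Z3) : ZMod r :=
  (v.1 : ZMod r) + (a : ZMod r) * (v.2.1 : ZMod r) + ((r - a : ℕ) : ZMod r) * (v.2.2 : ZMod r)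

/-- The weight map on `ℕ³`. -/
def wtN (r a : ℕ) (v : N3) : ZMod r := wtZ r a (toZ v)

/-- A `G`-set: contains the origin, closed under taking summands, and the weight map
restricted to it is a bijection onto `ℤ/rℤ`. -/
structure IsGSet (r a : ℕ) (Γ : Set N3) : Prop where
  zero_mem : (0, 0, 0) ∈ Γ
  dclosed : ∀ u v : N3, u + v ∈ Γ → u ∈ Γ ∧ v ∈ Γ
  bij : Set.BijOn (wtN r a) Γ Set.univ

/-- `wt_Γ(v)`: the (unique, for a `G`-set) element of `Γ` of the same weight as `v`. -/
noncomputable def wtG (r a : ℕ) (Γ : Set N3) (v : N3) : N3 :=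
  if h : ∃ w, w ∈ Γ ∧ wtN r a w = wtN r a v then h.choose else (0, 0, 0)

/-- `(m,n)` is a y-valley of `Γ`. -/
def IsYValley (Γ : Set N3) (m n : ℕ) : Prop :=
  (m, n, 0) ∈ Γ ∧ (m + 1, n, 0) ∈ Γ ∧ (m, n + 1, 0) ∈ Γ ∧ (m + 1, n + 1, 0) ∉ Γ

/-- `(m,n)` is a z-valley of `Γ`. -/
def IsZValley (Γ : Set N3) (m n : ℕ) : Prop :=
  (m, 0, n) ∈ Γ ∧ (m + 1, 0, n) ∈ Γ ∧ (m, 0, n + 1) ∈ Γ ∧ (m + 1, 0, n + 1) ∉ Γ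

/-- A primitive `G`-set: it has a y-valley `(i_y, 0)` and a z-valley `(i_z, 0)`. -/
def IsPrimG (Γ : Set N3) : Prop := (∃ p : ℕ, IsYValley Γ p 0) ∧ (∃ p : ℕ, IsZValley Γ p 0)

/-- `s_Γ(v) = v − wt_Γ(v) ∈ ℤ³`. -/
noncomputable def sG (r a : ℕ) (Γ : Set N3) (v : N3) : Z3 := toZ v - toZ (wtG r a Γ v)

/-- The submonoid `S(Γ)` of `ℤ³` generated by all `s_Γ(v)`. -/
noncomputable def SMon (r a : ℕ) (Γ : Set N3) : AddSubmonoid Z3 :=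
  AddSubmonoid.closure (Set.range (sG r a Γ))

/-- The lattice `M = { u ∈ ℤ³ : wt(u) = 0 }` of `G`-invariant monomials. -/
def latM (r a : ℕ) : Set Z3 := { u | wtZ r a u = 0 }

/-- The standard pairing of `ℝ³` with `ℤ³`. -/
def dotR (α : ℝ × ℝ × ℝ) (u : Z3) : ℝ :=
  α.1 * (u.1 : ℝ) + α.2.1 * (u.2.1 : ℝ) + α.2.2 * (u.2.2 : ℝ)

/-- The cone `σ(Γ) = { α ∈ ℝ³ : ⟨α, s_Γ(v)⟩ ≥ 0 for all v ∈ ℕ³ }`. -/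
noncomputable def sigmaCone (r a : ℕ) (Γ : Set N3) : Set (ℝ × ℝ × ℝ) :=
  { α | ∀ v : N3, 0 ≤ dotR α (sG r a Γ v) }

/-- `span(u₁,…,u_t)`: all `v ∈ ℕ³` dominated componentwise by some `u_s`. -/
def spanSet (s : Set N3) : Set N3 := { v | ∃ u ∈ s, v ≤ u }

/-- `i(Γ)`: the largest `m` with `(m,0,0) ∈ Γ`. -/
noncomputable def iOf (Γ : Set N3) : ℕ := sSup { m : ℕ | (m, 0, 0) ∈ Γ }

/-- `j(Γ)`: the largest `n` with `(0,n,0) ∈ Γ`. -/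
noncomputable def jOf (Γ : Set N3) : ℕ := sSup { n : ℕ | (0, n, 0) ∈ Γ }

/-- `k(Γ)`: the largest `p` with `(0,0,p) ∈ Γ`. -/
noncomputable def kOf (Γ : Set N3) : ℕ := sSup { p : ℕ | (0, 0, p) ∈ Γ }

/-- `c(w) = max { c : w − c·v ∈ ℕ³ }` (componentwise). -/
noncomputable def cmax (v w : N3) : ℕ := sSup { c : ℕ | c • v ≤ w }

/-- The `G`-igsaw transformation of `Γ` in the direction of `u`:
`T_u(Γ) = { w + c(w)·(u − v) : w ∈ Γ }` where `v = wt_Γ(u)`. -/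
noncomputable def jig (r a : ℕ) (Γ : Set N3) (u : N3) : Set N3 :=
  { w' | ∃ w ∈ Γ,
      toZ w' = toZ w + (cmax (wtG r a Γ u) w) • (toZ u - toZ (wtG r a Γ u)) }

/-- The upper transformation `TU(Γ)`. -/
noncomputable def TU (r a : ℕ) (Γ : Set N3) : Set N3 := jig r a Γ (iOf Γ + 1, 0, 0)

/-- The right transformation `TR(Γ)`. -/
noncomputable def TR (r a : ℕ) (Γ : Set N3) : Set N3 := jig r a Γ (0, jOf Γ + 1, 0)

/-- The left transformation `TL(Γ)`. -/
noncomputable def TL (r a : ℕ) (Γ : Set N3) : Set N3 := jig r a Γ (0, 0, kOf Γ + 1)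

/-- The y-valley of `Γ` (chosen by choice; unique for a `G`-set having one). -/
noncomputable def yValley (Γ : Set N3) : ℕ × ℕ :=
  if h : ∃ p : ℕ × ℕ, IsYValley Γ p.1 p.2 then h.choose else (0, 0)

/-- The z-valley of `Γ` (chosen by choice; unique for a `G`-set having one). -/
noncomputable def zValley (Γ : Set N3) : ℕ × ℕ :=
  if h : ∃ p : ℕ × ℕ, IsZValley Γ p.1 p.2 then h.choose else (0, 0)

/-- The upper right transformation `TUR(Γ)`, in the direction `(i_y+1, j_y+1, 0)`. -/
noncomputable def TUR (r a : ℕ) (Γ : Set N3) : Set N3 :=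
  jig r a Γ ((yValley Γ).1 + 1, (yValley Γ).2 + 1, 0)

/-- The upper left transformation `TUL(Γ)`, in the direction `(i_z+1, 0, k_z+1)`. -/
noncomputable def TUL (r a : ℕ) (Γ : Set N3) : Set N3 :=
  jig r a Γ ((zValley Γ).1 + 1, 0, (zValley Γ).2 + 1)

/-- The bound `min{j, k, j − j_y, k − k_z}` for the triangle of transformations. -/
noncomputable def minBound (Γ : Set N3) : ℕ :=
  min (min (jOf Γ) (kOf Γ)) (min (jOf Γ - (yValley Γ).2) (kOf Γ - (zValley Γ).2))

/-- The triangle of transformations `Θ(Γ)`. -/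
noncomputable def Theta (r a : ℕ) (Γ : Set N3) : Set (Set N3) :=
  { Γ' | ∃ p q : ℕ, p + q ≤ minBound Γ ∧ Γ' = (TUR r a)^[p] ((TUL r a)^[q] Γ) }

/-- The recursion step producing `Γ_{n+1}` from `Γ_n`. -/
noncomputable def nextGamma (r a : ℕ) (Γ : Set N3) : Set N3 :=
  if jOf Γ < kOf Γ then TU r a ((TUR r a)^[jOf Γ] Γ)
  else TU r a ((TUL r a)^[kOf Γ] Γ)

/-- The sequence of primitive `G`-sets; `GammaSeq r a b (n-1)` is `Γ_n`,
starting from `Γ₁ = span((1,0,0),(0,b−1,0),(0,0,r−b−1))`. -/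
noncomputable def GammaSeq (r a b : ℕ) : ℕ → Set N3
  | 0 => spanSet {(1, 0, 0), (0, b - 1, 0), (0, 0, r - b - 1)}
  | n + 1 => nextGamma r a (GammaSeq r a b n)


theorem wtN_mk {r a : ℕ} (har : a ≤ r) (m n p : ℕ) :
    wtN r a (m, n, p) = m + a * ((n : ZMod r) - p) := by
  simp only [wtN, wtZ, toZ, Nat.cast_sub har, CharP.cast_eq_zero, Int.cast_natCast]
  ring

theorem wtN_add (r a : ℕ) (v w : N3) : wtN r a (v + w) = wtN r a v + wtN r a w := by
  simp only [wtN, wtZ, toZ, Prod.fst_add, Prod.snd_add, Nat.cast_add, Int.cast_add]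
  ring

theorem wtG_eq_of_injOn {r a : ℕ} {Γ : Set N3} (hinj : Set.InjOn (wtN r a) Γ) {u v : N3}
    (hv : v ∈ Γ) (huv : wtN r a v = wtN r a u) : wtG r a Γ u = v := by
  have h : ∃ w, w ∈ Γ ∧ wtN r a w = wtN r a u := ⟨v, hv, huv⟩
  rw [wtG, dif_pos h]
  exact hinj h.choose_spec.1 hv (h.choose_spec.2.trans huv.symm)

theorem cmax_eq_zero {v w : N3} (h : ¬ v ≤ w) : cmax v w = 0 := by
  have hset : {c : ℕ | c • v ≤ w} = {0} := by
    ext c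
    refine ⟨fun hc => ?_, ?_⟩
    · by_contra hc0
      exact h ((le_self_nsmul zero_le hc0).trans hc)
    · rintro rfl
      simp
  rw [cmax, hset, csSup_singleton]

theorem cmax_eq_one {v w : N3} (h : v ≤ w) (h2 : ¬ 2 • v ≤ w) : cmax v w = 1 := by
  refine IsGreatest.csSup_eq ⟨by simpa using h, fun c hc => ?_⟩
  by_contra! hc1
  exact h2 ((nsmul_le_nsmul_left zero_le hc1).trans hc)

/-- When `2 • v` is dominated by no element of `Γ`, the transformation moves exactly the
elements above `v`, and translates each of them by `u - v`. -/
theorem mem_jig_iff {r a : ℕ} {Γ : Set N3} (hinj : Set.InjOn (wtN r a) Γ) {u v : N3}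
    (hv : v ∈ Γ) (huv : wtN r a v = wtN r a u) (h2 : ∀ w ∈ Γ, ¬ 2 • v ≤ w) (w' : N3) :
    w' ∈ jig r a Γ u ↔ (w' ∈ Γ ∧ ¬ v ≤ w') ∨ ∃ w ∈ Γ, v ≤ w ∧ w' + v = w + u := by
  rw [jig, Set.mem_ofPred_eq, wtG_eq_of_injOn hinj hv huv]
  constructor
  · rintro ⟨w, hw, h⟩
    by_cases hvw : v ≤ w
    · rw [cmax_eq_one hvw (h2 w hw)] at h
      refine Or.inr ⟨w, hw, hvw, ?_⟩
      simp only [toZ, one_smul, Prod.ext_iff, Prod.fst_add, Prod.snd_add, Prod.fst_sub,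
        Prod.snd_sub] at h ⊢
      omega
    · rw [cmax_eq_zero hvw] at h
      have : w' = w := by
        simp only [toZ, zero_smul, add_zero, Prod.ext_iff] at h ⊢
        omega
      exact Or.inl ⟨this ▸ hw, this ▸ hvw⟩
  · rintro (⟨hw, hvw⟩ | ⟨w, hw, hvw, h⟩)
    · exact ⟨w', hw, by rw [cmax_eq_zero hvw, zero_smul, add_zero]⟩
    · refine ⟨w, hw, ?_⟩
      rw [cmax_eq_one hvw (h2 w hw)]
      simp only [toZ, one_smul, Prod.ext_iff, Prod.fst_add, Prod.snd_add, Prod.fst_sub,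
        Prod.snd_sub] at h ⊢
      omega

theorem injOn_jig {r a : ℕ} {Γ : Set N3} (hinj : Set.InjOn (wtN r a) Γ) {u v : N3}
    (hv : v ∈ Γ) (huv : wtN r a v = wtN r a u) (h2 : ∀ w ∈ Γ, ¬ 2 • v ≤ w) :
    Set.InjOn (wtN r a) (jig r a Γ u) := by
  have hwt : ∀ w w' : N3, w' + v = w + u → wtN r a w' = wtN r a w := fun w w' h => by
    have := congrArg (wtN r a) h
    rwa [wtN_add, wtN_add, huv, add_left_inj] at this
  intro w₁ h₁ w₂ h₂ h
  rw [mem_jig_iff hinj hv huv h2] at h₁ h₂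
  rcases h₁ with ⟨h₁, hn₁⟩ | ⟨x₁, h₁, hl₁, he₁⟩ <;> rcases h₂ with ⟨h₂, hn₂⟩ | ⟨x₂, h₂, hl₂, he₂⟩
  · exact hinj h₁ h₂ h
  · exact absurd (hinj h₁ h₂ (h.trans (hwt _ _ he₂)) ▸ hl₂) hn₁
  · exact absurd (hinj h₂ h₁ (h.symm.trans (hwt _ _ he₁)) ▸ hl₁) hn₂
  · have hx := hinj h₁ h₂ ((hwt _ _ he₁).symm.trans (h.trans (hwt _ _ he₂)))
    exact add_right_cancel (he₁.trans ((congrArg (· + u) hx).trans he₂.symm))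

theorem mem_spanSet_triple (m n p m₁ n₁ p₁ m₂ n₂ p₂ m₃ n₃ p₃ : ℕ) :
    (m, n, p) ∈ spanSet {(m₁, n₁, p₁), (m₂, n₂, p₂), (m₃, n₃, p₃)} ↔
      (m ≤ m₁ ∧ n ≤ n₁ ∧ p ≤ p₁) ∨ (m ≤ m₂ ∧ n ≤ n₂ ∧ p ≤ p₂) ∨
        (m ≤ m₃ ∧ n ≤ n₃ ∧ p ≤ p₃) := by
  simp [spanSet, Prod.le_def]

theorem yValley_eq {Γ : Set N3} {p q : ℕ} (h : ∀ m n, IsYValley Γ m n ↔ m = p ∧ n = q) :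
    yValley Γ = (p, q) := by
  have hex : ∃ s : ℕ × ℕ, IsYValley Γ s.1 s.2 := ⟨(p, q), (h p q).2 ⟨rfl, rfl⟩⟩
  rw [yValley, dif_pos hex]
  exact Prod.ext_iff.2 ((h _ _).1 hex.choose_spec)

theorem zValley_eq {Γ : Set N3} {p q : ℕ} (h : ∀ m n, IsZValley Γ m n ↔ m = p ∧ n = q) :
    zValley Γ = (p, q) := by
  have hex : ∃ s : ℕ × ℕ, IsZValley Γ s.1 s.2 := ⟨(p, q), (h p q).2 ⟨rfl, rfl⟩⟩
  rw [zValley, dif_pos hex]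
  exact Prod.ext_iff.2 ((h _ _).1 hex.choose_spec)

theorem iOf_eq {Γ : Set N3} {i : ℕ} (h : ∀ m, (m, 0, 0) ∈ Γ ↔ m ≤ i) : iOf Γ = i := by
  have : {m : ℕ | (m, 0, 0) ∈ Γ} = Set.Iic i := Set.ext h
  rw [iOf, this, csSup_Iic]

/-- The relations between the corners and the weights of a primitive `G`-set. -/
theorem primitive_relations {r a : ℕ} (har : a ≤ r) {i iy iz j k : ℕ}
    (hΓ : IsGSet r a (spanSet {(i, 0, 0), (iy, j, 0), (iz, 0, k)}))
    (hiy : iy < i) (hiz : iz < i) (hj : 0 < j) (hk : 0 < k) :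
    i = iy + iz + 1 ∧ (iz : ZMod r) + 1 = a * (j + 1) ∧ (iy : ZMod r) + 1 = -(a * (k + 1)) := by
  have inj : ∀ m n p m' n' p' : ℕ,
      ((m ≤ i ∧ n ≤ 0 ∧ p ≤ 0) ∨ (m ≤ iy ∧ n ≤ j ∧ p ≤ 0) ∨ (m ≤ iz ∧ n ≤ 0 ∧ p ≤ k)) →
      ((m' ≤ i ∧ n' ≤ 0 ∧ p' ≤ 0) ∨ (m' ≤ iy ∧ n' ≤ j ∧ p' ≤ 0) ∨
        (m' ≤ iz ∧ n' ≤ 0 ∧ p' ≤ k)) →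
      (m : ZMod r) + a * ((n : ZMod r) - p) = m' + a * ((n' : ZMod r) - p') →
      m = m' ∧ n = n' ∧ p = p' := by
    intro m n p m' n' p' h h' he
    rw [← mem_spanSet_triple] at h h'
    rw [← wtN_mk har, ← wtN_mk har] at he
    simpa using hΓ.bij.injOn h h' he
  have surj : ∀ x : ZMod r, ∃ m n p : ℕ,
      ((m ≤ i ∧ n ≤ 0 ∧ p ≤ 0) ∨ (m ≤ iy ∧ n ≤ j ∧ p ≤ 0) ∨ (m ≤ iz ∧ n ≤ 0 ∧ p ≤ k)) ∧
      (m : ZMod r) + a * ((n : ZMod r) - p) = x := by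
    intro x
    obtain ⟨⟨m, n, p⟩, h, he⟩ := hΓ.bij.surjOn (Set.mem_univ x)
    exact ⟨m, n, p, (mem_spanSet_triple ..).1 h, by rw [← he, wtN_mk har]⟩
  have hz : (iz : ZMod r) + 1 = a * (j + 1) := by
    obtain ⟨m, n, p, hm, he⟩ := surj (iz + 1 - a)
    rcases m with _ | m
    · rcases p with _ | p
      · obtain rfl | hn := eq_or_ne n j
        · push_cast at he; linear_combination -he
        · have := inj 0 (n + 1) 0 (iz + 1) 0 0 (by omega) (by omega)
            (by push_cast at he ⊢; linear_combination he)
          omega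
      · have := inj 0 n p (iz + 1) 0 0 (by omega) (by omega)
          (by push_cast at he ⊢; linear_combination he)
        omega
    · have := inj m n p iz 0 1 (by omega) (by omega)
        (by push_cast at he ⊢; linear_combination he)
      omega
  have hy : (iy : ZMod r) + 1 = -(a * (k + 1)) := by
    obtain ⟨m, n, p, hm, he⟩ := surj (iy + 1 + a)
    rcases m with _ | m
    · rcases n with _ | n
      · obtain rfl | hp := eq_or_ne p k
        · push_cast at he; linear_combination -he
        · have := inj 0 0 (p + 1) (iy + 1) 0 0 (by omega) (by omega)
            (by push_cast at he ⊢; linear_combination he)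
          omega
      · have := inj 0 n p (iy + 1) 0 0 (by omega) (by omega)
          (by push_cast at he ⊢; linear_combination he)
        omega
    · have := inj m n p iy 1 0 (by omega) (by omega)
        (by push_cast at he ⊢; linear_combination he)
      omega
  refine ⟨?_, hz, hy⟩
  have axis : ∀ m : ℕ, m ≤ i → ∀ t : ℤ, -k ≤ t → t ≤ j → (m : ZMod r) = a * t → m = 0 := by
    intro m hm t ht ht' he
    obtain ⟨n, rfl | rfl⟩ := t.eq_nat_or_neg
    · exact (inj m 0 0 0 n 0 (by omega) (by omega)
        (by push_cast at he ⊢; linear_combination he)).1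
    · exact (inj m 0 0 0 0 n (by omega) (by omega)
        (by push_cast at he ⊢; linear_combination he)).1
  obtain ⟨t, ht, ht', he⟩ : ∃ t : ℤ, -k ≤ t ∧ t ≤ j ∧ (i : ZMod r) + 1 = a * t := by
    obtain ⟨m, n, p, hm, he⟩ := surj (i + 1)
    rcases m with _ | m
    · exact ⟨n - p, by omega, by omega, by push_cast at he ⊢; linear_combination -he⟩
    · have := inj m n p i 0 0 (by omega) (by omega)
        (by push_cast at he ⊢; linear_combination he)
      omega
  have ht₁ : t ≤ j - k := by
    by_contra! h
    have := axis (i - iz) (by omega) (t - j - 1) (by omega) (by omega)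
      (by rw [Nat.cast_sub hiz.le]; push_cast; linear_combination he - hz)
    omega
  have ht₂ : j - k ≤ t := by
    by_contra! h
    have := axis (i - iy) (by omega) (t + k + 1) (by omega) (by omega)
      (by rw [Nat.cast_sub hiy.le]; push_cast; linear_combination he - hy)
    omega
  obtain rfl : t = j - k := le_antisymm ht₁ ht₂
  push_cast at he
  rcases le_total i (iy + iz + 1) with h | h
  · have := axis (iy + iz + 1 - i) (by omega) 0 (by omega) (by omega)
      (by rw [Nat.cast_sub h]; push_cast; linear_combination hy + hz - he)
    omega
  · have := axis (i - (iy + iz + 1)) (by omega) 0 (by omega) (by omega)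
      (by rw [Nat.cast_sub h]; push_cast; linear_combination he - hy - hz)
    omega

/-- The iterates of the upper right transformation on a primitive `G`-set. -/
theorem iterate_TUR {r a : ℕ} (har : a ≤ r) {i iy iz j k : ℕ}
    (hinj : Set.InjOn (wtN r a) (spanSet {(i, 0, 0), (iy, j, 0), (iz, 0, k)}))
    (hi : i = iy + iz + 1) (hw : (iy : ZMod r) + 1 = -(a * (k + 1))) (hjk : j < k) (p : ℕ)
    (hp : p ≤ j) :
    (TUR r a)^[p] (spanSet {(i, 0, 0), (iy, j, 0), (iz, 0, k)}) =
        spanSet {(i, p, 0), (iy, j, 0), (iz, 0, k - p)} ∧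
      Set.InjOn (wtN r a) (spanSet {(i, p, 0), (iy, j, 0), (iz, 0, k - p)}) := by
  induction p with
  | zero => simpa using hinj
  | succ p ih =>
    obtain ⟨hp₁, hp₂⟩ := ih (by omega)
    have hv : (0, 0, k - p) ∈ spanSet {(i, p, 0), (iy, j, 0), (iz, 0, k - p)} := by
      rw [mem_spanSet_triple]; omega
    have huv : wtN r a (0, 0, k - p) = wtN r a (iy + 1, p + 1, 0) := by
      rw [wtN_mk har, wtN_mk har, Nat.cast_sub (by omega : p ≤ k)]
      push_cast
      linear_combination -hw
    have h2 : ∀ w ∈ spanSet {(i, p, 0), (iy, j, 0), (iz, 0, k - p)},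
        ¬ 2 • ((0, 0, k - p) : N3) ≤ w := by
      rintro ⟨x, y, z⟩ h
      rw [mem_spanSet_triple] at h
      simp only [Prod.smul_mk, smul_eq_mul, Prod.mk_le_mk]
      omega
    have hval : yValley (spanSet {(i, p, 0), (iy, j, 0), (iz, 0, k - p)}) = (iy, p) := by
      refine yValley_eq fun m n => ?_
      simp only [IsYValley, mem_spanSet_triple]
      omega
    have hjig : jig r a (spanSet {(i, p, 0), (iy, j, 0), (iz, 0, k - p)}) (iy + 1, p + 1, 0) =
        spanSet {(i, p + 1, 0), (iy, j, 0), (iz, 0, k - (p + 1))} := by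
      ext ⟨x, y, z⟩
      rw [mem_jig_iff hp₂ hv huv h2]
      simp only [Prod.exists, mem_spanSet_triple, Prod.mk_le_mk, Prod.mk_add_mk, Prod.mk.injEq]
      constructor
      · rintro (h | ⟨x', y', z', h⟩) <;> omega
      · intro h
        by_cases hm : iy < x ∧ y = p + 1
        · refine Or.inr ⟨x - (iy + 1), 0, k - p, ?_⟩
          omega
        · left
          omega
    rw [Function.iterate_succ_apply', hp₁, TUR, hval, hjig]
    exact ⟨rfl, hjig ▸ injOn_jig hp₂ hv huv h2⟩

/-- The upper transformation of the last iterate of the upper right transformation. -/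
theorem TU_iterate_TUR {r a : ℕ} (har : a ≤ r) {i iy iz j k : ℕ}
    (hinj : Set.InjOn (wtN r a) (spanSet {(i, 0, 0), (iy, j, 0), (iz, 0, k)}))
    (hi : i = iy + iz + 1) (hwy : (iy : ZMod r) + 1 = -(a * (k + 1)))
    (hwz : (iz : ZMod r) + 1 = a * (j + 1)) (hjk : j < k) :
    TU r a ((TUR r a)^[j] (spanSet {(i, 0, 0), (iy, j, 0), (iz, 0, k)})) =
      spanSet {(i + iz + 1, 0, 0), (i, j, 0), (iz, 0, k - (j + 1))} := by
  obtain ⟨hj₁, hj₂⟩ := iterate_TUR har hinj hi hwy hjk j le_rfl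
  have hv : (0, 0, k - j) ∈ spanSet {(i, j, 0), (iy, j, 0), (iz, 0, k - j)} := by
    rw [mem_spanSet_triple]; omega
  have huv : wtN r a (0, 0, k - j) = wtN r a (i + 1, 0, 0) := by
    rw [wtN_mk har, wtN_mk har, Nat.cast_sub hjk.le, hi]
    push_cast
    linear_combination -hwy - hwz
  have h2 : ∀ w ∈ spanSet {(i, j, 0), (iy, j, 0), (iz, 0, k - j)},
      ¬ 2 • ((0, 0, k - j) : N3) ≤ w := by
    rintro ⟨x, y, z⟩ h
    rw [mem_spanSet_triple] at h
    simp only [Prod.smul_mk, smul_eq_mul, Prod.mk_le_mk]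
    omega
  have hiOf : iOf (spanSet {(i, j, 0), (iy, j, 0), (iz, 0, k - j)}) = i := by
    refine iOf_eq fun m => ?_
    rw [mem_spanSet_triple]
    omega
  rw [hj₁, TU, hiOf]
  ext ⟨x, y, z⟩
  rw [mem_jig_iff hj₂ hv huv h2]
  simp only [Prod.exists, mem_spanSet_triple, Prod.mk_le_mk, Prod.mk_add_mk, Prod.mk.injEq]
  constructor
  · rintro (h | ⟨x', y', z', h⟩) <;> omega
  · intro h
    by_cases hm : i < x
    · refine Or.inr ⟨x - (i + 1), 0, k - j, ?_⟩
      omega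
    · left
      omega

/-- The iterates of the upper left transformation on a primitive `G`-set. -/
theorem iterate_TUL {r a : ℕ} (har : a ≤ r) {i iy iz j k : ℕ}
    (hinj : Set.InjOn (wtN r a) (spanSet {(i, 0, 0), (iy, 0, j), (iz, k, 0)}))
    (hi : i = iy + iz + 1) (hw : (iy : ZMod r) + 1 = a * (k + 1)) (hjk : j < k) (p : ℕ)
    (hp : p ≤ j) :
    (TUL r a)^[p] (spanSet {(i, 0, 0), (iy, 0, j), (iz, k, 0)}) =
        spanSet {(i, 0, p), (iy, 0, j), (iz, k - p, 0)} ∧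
      Set.InjOn (wtN r a) (spanSet {(i, 0, p), (iy, 0, j), (iz, k - p, 0)}) := by
  induction p with
  | zero => simpa using hinj
  | succ p ih =>
    obtain ⟨hp₁, hp₂⟩ := ih (by omega)
    have hv : (0, k - p, 0) ∈ spanSet {(i, 0, p), (iy, 0, j), (iz, k - p, 0)} := by
      rw [mem_spanSet_triple]; omega
    have huv : wtN r a (0, k - p, 0) = wtN r a (iy + 1, 0, p + 1) := by
      rw [wtN_mk har, wtN_mk har, Nat.cast_sub (by omega : p ≤ k)]
      push_cast
      linear_combination -hw
    have h2 : ∀ w ∈ spanSet {(i, 0, p), (iy, 0, j), (iz, k - p, 0)},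
        ¬ 2 • ((0, k - p, 0) : N3) ≤ w := by
      rintro ⟨x, y, z⟩ h
      rw [mem_spanSet_triple] at h
      simp only [Prod.smul_mk, smul_eq_mul, Prod.mk_le_mk]
      omega
    have hval : zValley (spanSet {(i, 0, p), (iy, 0, j), (iz, k - p, 0)}) = (iy, p) := by
      refine zValley_eq fun m n => ?_
      simp only [IsZValley, mem_spanSet_triple]
      omega
    have hjig : jig r a (spanSet {(i, 0, p), (iy, 0, j), (iz, k - p, 0)}) (iy + 1, 0, p + 1) =
        spanSet {(i, 0, p + 1), (iy, 0, j), (iz, k - (p + 1), 0)} := by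
      ext ⟨x, y, z⟩
      rw [mem_jig_iff hp₂ hv huv h2]
      simp only [Prod.exists, mem_spanSet_triple, Prod.mk_le_mk, Prod.mk_add_mk, Prod.mk.injEq]
      constructor
      · rintro (h | ⟨x', y', z', h⟩) <;> omega
      · intro h
        by_cases hm : iy < x ∧ z = p + 1
        · refine Or.inr ⟨x - (iy + 1), k - p, 0, ?_⟩
          omega
        · left
          omega
    rw [Function.iterate_succ_apply', hp₁, TUL, hval, hjig]
    exact ⟨rfl, hjig ▸ injOn_jig hp₂ hv huv h2⟩

/-- The upper transformation of the last iterate of the upper left transformation. -/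
theorem TU_iterate_TUL {r a : ℕ} (har : a ≤ r) {i iy iz j k : ℕ}
    (hinj : Set.InjOn (wtN r a) (spanSet {(i, 0, 0), (iy, 0, j), (iz, k, 0)}))
    (hi : i = iy + iz + 1) (hwy : (iy : ZMod r) + 1 = a * (k + 1))
    (hwz : (iz : ZMod r) + 1 = -(a * (j + 1))) (hjk : j < k) :
    TU r a ((TUL r a)^[j] (spanSet {(i, 0, 0), (iy, 0, j), (iz, k, 0)})) =
      spanSet {(i + iz + 1, 0, 0), (i, 0, j), (iz, k - (j + 1), 0)} := by
  obtain ⟨hj₁, hj₂⟩ := iterate_TUL har hinj hi hwy hjk j le_rfl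
  have hv : (0, k - j, 0) ∈ spanSet {(i, 0, j), (iy, 0, j), (iz, k - j, 0)} := by
    rw [mem_spanSet_triple]; omega
  have huv : wtN r a (0, k - j, 0) = wtN r a (i + 1, 0, 0) := by
    rw [wtN_mk har, wtN_mk har, Nat.cast_sub hjk.le, hi]
    push_cast
    linear_combination -hwy - hwz
  have h2 : ∀ w ∈ spanSet {(i, 0, j), (iy, 0, j), (iz, k - j, 0)},
      ¬ 2 • ((0, k - j, 0) : N3) ≤ w := by
    rintro ⟨x, y, z⟩ h
    rw [mem_spanSet_triple] at h
    simp only [Prod.smul_mk, smul_eq_mul, Prod.mk_le_mk]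
    omega
  have hiOf : iOf (spanSet {(i, 0, j), (iy, 0, j), (iz, k - j, 0)}) = i := by
    refine iOf_eq fun m => ?_
    rw [mem_spanSet_triple]
    omega
  rw [hj₁, TU, hiOf]
  ext ⟨x, y, z⟩
  rw [mem_jig_iff hj₂ hv huv h2]
  simp only [Prod.exists, mem_spanSet_triple, Prod.mk_le_mk, Prod.mk_add_mk, Prod.mk.injEq]
  constructor
  · rintro (h | ⟨x', y', z', h⟩) <;> omega
  · intro h
    by_cases hm : i < x
    · refine Or.inr ⟨x - (i + 1), k - j, 0, ?_⟩
      omega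
    · left
      omega

/-- Producing a new (eventually primitive) `G`-set from a primitive one. -/
theorem stmt15 (r a : ℕ) (hra : Nat.Coprime r a) (ha2 : 2 ≤ a) (halt : a < r - a) (Γ : Set N3) (hΓ : IsGSet r a Γ)
    (i iy iz j k : ℕ)
    (hyv : IsYValley Γ iy 0) (hzv : IsZValley Γ iz 0)
    (hyu : ∀ m n : ℕ, IsYValley Γ m n → (m, n) = (iy, 0))
    (hzu : ∀ m n : ℕ, IsZValley Γ m n → (m, n) = (iz, 0))
    (hspan : Γ = spanSet {(i, 0, 0), (iy, j, 0), (iz, 0, k)})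
    (hi : (i, 0, 0) ∈ Γ ∧ (i + 1, 0, 0) ∉ Γ)
    (hj : (0, j, 0) ∈ Γ ∧ (0, j + 1, 0) ∉ Γ)
    (hk : (0, 0, k) ∈ Γ ∧ (0, 0, k + 1) ∉ Γ) :
    (j < k →
      TU r a ((TUR r a)^[j] Γ) =
        spanSet {(i + iz + 1, 0, 0), (i, j, 0), (iz, 0, k - (j + 1))} ∧
      (j < k - 1 → IsPrimG (TU r a ((TUR r a)^[j] Γ)))) ∧
    (k < j →
      TU r a ((TUL r a)^[k] Γ) =
        spanSet {(i + iy + 1, 0, 0), (iy, j - (k + 1), 0), (i, 0, k)} ∧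
      (k < j - 1 → IsPrimG (TU r a ((TUL r a)^[k] Γ)))) := by
  have har : a ≤ r := by omega
  subst hspan
  simp only [IsYValley, mem_spanSet_triple] at hyv
  simp only [IsZValley, mem_spanSet_triple] at hzv
  obtain ⟨hi', hz, hy⟩ := primitive_relations har hΓ (by omega) (by omega) (by omega) (by omega)
  refine ⟨fun hjk => ?_, fun hkj => ?_⟩
  · rw [TU_iterate_TUR har hΓ.bij.injOn hi' hy hz hjk]
    refine ⟨rfl, fun hjk' => ⟨⟨i, ?_⟩, ⟨iz, ?_⟩⟩⟩
    · simp only [IsYValley, mem_spanSet_triple]; omega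
    · simp only [IsZValley, mem_spanSet_triple]; omega
  · have hset : (spanSet {(i, 0, 0), (iy, j, 0), (iz, 0, k)} : Set N3) =
        spanSet {(i, 0, 0), (iz, 0, k), (iy, j, 0)} := by
      rw [Set.pair_comm]
    rw [hset] at hΓ ⊢
    rw [TU_iterate_TUL har hΓ.bij.injOn (by omega) hz hy hkj, Set.pair_comm]
    refine ⟨rfl, fun hkj' => ⟨⟨iy, ?_⟩, ⟨i, ?_⟩⟩⟩
    · simp only [IsYValley, mem_spanSet_triple]; omega
    · simp only [IsZValley, mem_spanSet_triple]; omega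

end GH
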